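/- arXiv:1001.1822 — 2 statements merged into one kernel-verified Lean document; each statement's English description precedes it below -/
import Mathlib

section
/- Let ψ : (0,∞) → (0,∞) be a C¹ increasing function with ψ' > 0 everywhere, and let h : ℝⁿ → ℝ be a C² function with h(x) ≥ 1 for all x. Then for every smooth compactly supported function f : ℝⁿ → ℝ, ∫ (−Lh/ψ(h)) f² dμ ≤ ∫ |∇f|²/ψ'(h) dμ. -/
open MeasureTheory Real Set
open scoped ENNReal RealInnerProductSpace

noncomputable section

abbrev En (n : ℕ) := EuclideanSpace ℝ (Fin n)

/-- The Laplacian on `ℝⁿ`: sum of second partial derivatives. -/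
def lapl {n : ℕ} (g : En n → ℝ) (x : En n) : ℝ :=
  ∑ i : Fin n,
    fderiv ℝ (fun y => fderiv ℝ g y (EuclideanSpace.single i 1)) x (EuclideanSpace.single i 1)

/-- The diffusion operator `L g = Δ g - ∇V · ∇g`. -/
def Lop {n : ℕ} (V g : En n → ℝ) (x : En n) : ℝ :=
  lapl g x - ⟪gradient V x, gradient g x⟫

/-- The Boltzmann measure `dμ = e^{-V}/Z dx`. -/
def boltz {n : ℕ} (V : En n → ℝ) : Measure (En n) :=
  (volume : Measure (En n)).withDensity
    (fun x => ENNReal.ofReal (Real.exp (-V x) / ∫ y, Real.exp (-V y)))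

theorem integral_fderiv_apply_eq_zero {n : ℕ} {F : En n → ℝ} (hF : ContDiff ℝ 1 F)
    (hFc : HasCompactSupport F) (v : En n) :
    Integrable (fun x => fderiv ℝ F x v) ∧ ∫ x, fderiv ℝ F x v = 0 := by
  have hF_int : Integrable (fun x => fderiv ℝ F x v) :=
    ((hF.continuous_fderiv one_ne_zero).clm_apply continuous_const).integrable_of_hasCompactSupport
      (hFc.fderiv_apply ℝ v)
  refine ⟨hF_int, ?_⟩
  have key := integral_mul_fderiv_eq_neg_fderiv_mul_of_integrable (𝕜 := ℝ) (μ := volume)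
    (f := fun _ : En n => (1 : ℝ)) (g := F) (v := v) (by simp) (by simpa using hF_int)
    (by simpa using hF.continuous.integrable_of_hasCompactSupport hFc)
    (by fun_prop) (fun x _ => hF.differentiable one_ne_zero x)
  simpa using key

theorem gradient_apply_eq_fderiv_single {n : ℕ} (g : En n → ℝ) (x : En n) (i : Fin n) :
    gradient g x i = fderiv ℝ g x (EuclideanSpace.single i 1) := by
  have : ⟪gradient g x, EuclideanSpace.single i (1 : ℝ)⟫
      = fderiv ℝ g x (EuclideanSpace.single i 1) := by
    simp only [gradient, InnerProductSpace.toDual_symm_apply]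
  rw [← this, EuclideanSpace.inner_single_right]
  simp

theorem inner_gradient_eq_sum {n : ℕ} (g k : En n → ℝ) (x : En n) :
    ⟪gradient g x, gradient k x⟫ = ∑ i : Fin n,
      fderiv ℝ g x (EuclideanSpace.single i 1) * fderiv ℝ k x (EuclideanSpace.single i 1) := by
  simp only [PiLp.inner_apply, gradient_apply_eq_fderiv_single]
  exact Finset.sum_congr rfl fun i _ => by simp [mul_comm]

theorem norm_gradient_sq_eq_sum {n : ℕ} (g : En n → ℝ) (x : En n) :
    ‖gradient g x‖ ^ 2 = ∑ i : Fin n, fderiv ℝ g x (EuclideanSpace.single i 1) ^ 2 := by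
  rw [← real_inner_self_eq_norm_sq, inner_gradient_eq_sum]
  exact Finset.sum_congr rfl fun i _ => by ring

theorem integral_boltz {n : ℕ} {V : En n → ℝ} (hV : Continuous V) (g : En n → ℝ) :
    ∫ x, g x ∂(boltz V) = (∫ y, Real.exp (-V y))⁻¹ * ∫ x, Real.exp (-V x) * g x := by
  have hZ : 0 ≤ ∫ y, Real.exp (-V y) := integral_nonneg fun y => (Real.exp_pos _).le
  rw [boltz, integral_withDensity_eq_integral_toReal_smul (by fun_prop) (by simp),
    ← integral_const_mul]
  refine integral_congr_ae (.of_forall fun x => ?_)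
  simp only [smul_eq_mul]
  rw [ENNReal.toReal_ofReal (by positivity)]
  ring

theorem fderiv_weighted_mul_apply {n : ℕ} {V h f u : En n → ℝ} {ψ : ℝ → ℝ} {x : En n}
    (hV : DifferentiableAt ℝ V x) (hh : DifferentiableAt ℝ h x) (hf : DifferentiableAt ℝ f x)
    (hu : DifferentiableAt ℝ u x) (hψ : DifferentiableAt ℝ ψ (h x)) (hψ0 : ψ (h x) ≠ 0)
    (v : En n) :
    fderiv ℝ (fun y => u y * (f y ^ 2 * (ψ (h y))⁻¹ * Real.exp (-V y))) x v =
      Real.exp (-V x) * ((fderiv ℝ u x v - fderiv ℝ V x v * u x) / ψ (h x) * f x ^ 2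
        + 2 * f x * fderiv ℝ f x v * u x / ψ (h x)
        - f x ^ 2 * deriv ψ (h x) * fderiv ℝ h x v * u x / ψ (h x) ^ 2) := by
  have h1 := (hψ.hasDerivAt.inv hψ0).comp_hasFDerivAt x hh.hasFDerivAt
  have h2 := hu.hasFDerivAt.mul (((hf.hasFDerivAt.pow 2).mul h1).mul hV.hasFDerivAt.neg.exp)
  refine (congrArg (fun A : En n →L[ℝ] ℝ => A v) h2.fderiv).trans ?_
  simp
  field_simp
  ring

theorem neg_le_of_young {E a b p q r t : ℝ} (hE : 0 ≤ E) (hp : 0 < p) (hq : 0 < q) :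
    E * (-a / p * t ^ 2) ≤
      -(E * (a / p * t ^ 2 + 2 * t * r * b / p - t ^ 2 * q * b * b / p ^ 2))
        + E * (r ^ 2 / q) := by
  have : 0 ≤ E * ((r - t * q * b / p) ^ 2 / q) := by positivity
  have e : E * ((r - t * q * b / p) ^ 2 / q) =
      -(E * (a / p * t ^ 2 + 2 * t * r * b / p - t ^ 2 * q * b * b / p ^ 2))
        + E * (r ^ 2 / q) - E * (-a / p * t ^ 2) := by
    field_simp
    ring
  linarith

/-- key Lemma, weighted form: if `ψ : (0,∞) → (0,∞)` is `C¹` increasing with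
`ψ' > 0`, and `h ≥ 1` is `C²`, then for every smooth compactly supported `f`,
`∫ (-Lh/ψ(h)) f² dμ ≤ ∫ |∇f|²/ψ'(h) dμ`. -/
theorem stmt0 {n : ℕ} (hn : 0 < n) (V : En n → ℝ) (hV : ContDiff ℝ 2 V)
    (hVint : Integrable (fun x => Real.exp (-V x)))
    (ψ : ℝ → ℝ)
    (hψpos : ∀ t ∈ Ioi (0 : ℝ), 0 < ψ t)
    (hψC1 : ContDiffOn ℝ 1 ψ (Ioi 0))
    (hψmono : StrictMonoOn ψ (Ioi 0))
    (hψ' : ∀ t ∈ Ioi (0 : ℝ), 0 < deriv ψ t)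
    (h : En n → ℝ) (hh : ContDiff ℝ 2 h) (hh1 : ∀ x, 1 ≤ h x)
    (f : En n → ℝ) (hf : ContDiff ℝ (⊤ : ℕ∞) f) (hfc : HasCompactSupport f) :
    ∫ x, (-(Lop V h x) / ψ (h x)) * (f x) ^ 2 ∂(boltz V)
      ≤ ∫ x, ‖gradient f x‖ ^ 2 / deriv ψ (h x) ∂(boltz V) := by
  have hpos : ∀ x, h x ∈ Ioi (0 : ℝ) := fun x => lt_of_lt_of_le one_pos (hh1 x)
  have hψh : ContDiff ℝ 1 fun x => ψ (h x) :=
    contDiffOn_univ.1 (hψC1.comp (hh.of_le one_le_two).contDiffOn fun x _ => hpos x)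
  have hψ'h : Continuous fun x => deriv ψ (h x) :=
    (hψC1.continuousOn_deriv_of_isOpen isOpen_Ioi le_rfl).comp_continuous hh.continuous hpos
  have hψ0 : ∀ x, ψ (h x) ≠ 0 := fun x => (hψpos _ (hpos x)).ne'
  have hψd : ∀ x, DifferentiableAt ℝ ψ (h x) := fun x =>
    (hψC1.differentiableOn one_ne_zero).differentiableAt (isOpen_Ioi.mem_nhds (hpos x))
  have hf1 : ContDiff ℝ 1 f := hf.of_le (by exact_mod_cast le_top)
  have hV1 : ContDiff ℝ 1 V := hV.of_le one_le_two
  have hh' : ContDiff ℝ 1 h := hh.of_le one_le_two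
  let e : Fin n → En n := fun i => EuclideanSpace.single i 1
  have hu : ∀ i, ContDiff ℝ 1 fun y => fderiv ℝ h y (e i) := fun i =>
    (hh.fderiv_right (by norm_num)).clm_apply contDiff_const
  let F : Fin n → En n → ℝ := fun i y =>
    fderiv ℝ h y (e i) * (f y ^ 2 * (ψ (h y))⁻¹ * Real.exp (-V y))
  have hF : ∀ i, ContDiff ℝ 1 (F i) := fun i =>
    (hu i).mul (((hf1.pow 2).mul (hψh.inv hψ0)).mul hV1.neg.exp)
  have hFc : ∀ i, HasCompactSupport (F i) := fun i =>
    hfc.mono fun x hx hfx => hx (by simp [F, hfx])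
  have hdiv := fun i => integral_fderiv_apply_eq_zero (hF i) (hFc i) (e i)
  have hcl : ∀ {g : En n → ℝ}, ContDiff ℝ 1 g → ∀ i, Continuous fun x => fderiv ℝ g x (e i) :=
    fun hg i => (hg.continuous_fderiv one_ne_zero).clm_apply continuous_const
  have hL : Continuous (Lop V h) := by
    have : Lop V h = fun x => ∑ i, fderiv ℝ (fun y => fderiv ℝ h y (e i)) x (e i)
        - ∑ i, fderiv ℝ V x (e i) * fderiv ℝ h x (e i) := by
      funext x
      rw [Lop, lapl, inner_gradient_eq_sum]
    rw [this]
    exact (continuous_finsetSum _ fun i _ => hcl (hu i) i).sub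
      (continuous_finsetSum _ fun i _ => (hcl hV1 i).mul (hcl hh' i))
  have hexp : Continuous fun x => Real.exp (-V x) := hV.continuous.neg.rexp
  have hlhs : Integrable fun x => Real.exp (-V x) * (-(Lop V h x) / ψ (h x) * f x ^ 2) :=
    (hexp.mul ((hL.neg.div hψh.continuous hψ0).mul
      (hf1.continuous.pow 2))).integrable_of_hasCompactSupport
      (hfc.mono fun x hx hfx => hx (by simp [hfx]))
  have hrhs : Integrable fun x => Real.exp (-V x) * (‖gradient f x‖ ^ 2 / deriv ψ (h x)) := by
    have hg : Continuous fun x => ‖gradient f x‖ ^ 2 := by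
      simp only [norm_gradient_sq_eq_sum]
      exact continuous_finsetSum _ fun i _ => (hcl hf1 i).pow 2
    refine (hexp.mul (hg.div hψ'h fun x => (hψ' _ (hpos x)).ne')).integrable_of_hasCompactSupport
      ((hfc.fderiv ℝ).mono fun x hx hfx => hx ?_)
    simp [gradient, hfx]
  rw [integral_boltz hV.continuous, integral_boltz hV.continuous]
  refine mul_le_mul_of_nonneg_left ?_
    (inv_nonneg.2 (integral_nonneg fun y => (Real.exp_pos _).le))
  have hsum : Integrable fun x => ∑ i, fderiv ℝ (F i) x (e i) :=
    integrable_finsetSum _ fun i _ => (hdiv i).1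
  have hzero : ∫ x, ∑ i, fderiv ℝ (F i) x (e i) = 0 := by
    rw [integral_finsetSum _ fun i _ => (hdiv i).1]
    exact Finset.sum_eq_zero fun i _ => (hdiv i).2
  calc ∫ x, Real.exp (-V x) * (-(Lop V h x) / ψ (h x) * f x ^ 2)
      ≤ ∫ x, (-(∑ i, fderiv ℝ (F i) x (e i))
          + Real.exp (-V x) * (‖gradient f x‖ ^ 2 / deriv ψ (h x))) := by
        refine integral_mono hlhs (hsum.neg.add hrhs) fun x => ?_
        have hlap : Lop V h x = ∑ i, (fderiv ℝ (fun y => fderiv ℝ h y (e i)) x (e i)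
            - fderiv ℝ V x (e i) * fderiv ℝ h x (e i)) := by
          rw [Lop, lapl, inner_gradient_eq_sum, ← Finset.sum_sub_distrib]
        have hpt := fun i => fderiv_weighted_mul_apply
          (hV1.differentiable one_ne_zero x) (hh'.differentiable one_ne_zero x)
          (hf1.differentiable one_ne_zero x) ((hu i).differentiable one_ne_zero x)
          (hψd x) (hψ0 x) (e i)
        simp only [F, hpt, hlap, norm_gradient_sq_eq_sum]
        rw [← Finset.sum_neg_distrib, ← Finset.sum_neg_distrib, Finset.sum_div, Finset.sum_mul,
          Finset.mul_sum, Finset.sum_div, Finset.mul_sum, ← Finset.sum_add_distrib]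
        exact Finset.sum_le_sum fun i _ =>
          neg_le_of_young (Real.exp_pos _).le (hψpos _ (hpos x)) (hψ' _ (hpos x))
    _ = ∫ x, Real.exp (-V x) * (‖gradient f x‖ ^ 2 / deriv ψ (h x)) := by
        rw [integral_add (by exact hsum.neg) hrhs, integral_neg, hzero, neg_zero, zero_add]
end
end

section
/- Every log-concave probability measure on ℝⁿ satisfies a Poincaré inequality: if V : ℝⁿ → ℝ is convex with ∫ e^{-V(x)} dx < ∞ and μ is the probability measure with density e^{-V}/Z with respect to Lebesgue measure, then there exists C > 0 such that for every smooth compactly supported function f, Var_μ(f) ≤ C ∫ |∇f|² dμ. -/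
open MeasureTheory Real Set
open scoped ENNReal RealInnerProductSpace

noncomputable section

section LogConcave

variable {E : Type*} [NormedAddCommGroup E] [NormedSpace ℝ E]

/-- A convex function that is at least `V 0 + 1` outside a ball grows at least linearly. -/
theorem ConvexOn.linear_growth_of_far {V : E → ℝ} (hV : ConvexOn ℝ univ V) {R : ℝ} (hR : 0 < R)
    (hfar : ∀ x, R ≤ ‖x‖ → V 0 + 1 ≤ V x) {x : E} (hx : R ≤ ‖x‖) :
    V 0 + R⁻¹ * ‖x‖ ≤ V x := by
  have hx0 : 0 < ‖x‖ := hR.trans_le hx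
  set t := R / ‖x‖ with ht
  have ht0 : 0 < t := by positivity
  have ht1 : t ≤ 1 := (div_le_one hx0).2 hx
  have hconv := hV.2 (mem_univ (0 : E)) (mem_univ x) (sub_nonneg.2 ht1) ht0.le (by ring)
  have hnorm : ‖t • x‖ = R := by
    rw [norm_smul, norm_of_nonneg ht0.le, ht, div_mul_cancel₀ _ hx0.ne']
  have hlow := hfar (t • x) hnorm.ge
  simp only [smul_zero, zero_add, smul_eq_mul] at hconv
  have h1 : 1 ≤ t * (V x - V 0) := by nlinarith
  have h2 : R⁻¹ * ‖x‖ = t⁻¹ := by rw [ht, inv_div]; ring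
  have h3 : t⁻¹ ≤ V x - V 0 := by
    rw [inv_le_iff_one_le_mul₀ ht0]; linarith
  linarith

variable [MeasurableSpace E] [BorelSpace E] [FiniteDimensional ℝ E]
  (ν : Measure E) [ν.IsAddHaarMeasure]

/-- A convex function `V` with `e^{-V}` integrable is at least `V 0 + 1` outside some ball. -/
theorem ConvexOn.exists_far_of_integrable {V : E → ℝ} (hV : ConvexOn ℝ univ V)
    (hint : Integrable (fun x => exp (-V x)) ν) :
    ∃ R : ℝ, 0 < R ∧ ∀ x, R ≤ ‖x‖ → V 0 + 1 ≤ V x := by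
  have hcont : Continuous V := continuousOn_univ.1 (hV.continuousOn isOpen_univ)
  obtain ⟨B₀, hB₀⟩ := (isCompact_closedBall (0 : E) 1).bddAbove_image hcont.continuousOn
  set B := max B₀ (V 0 + 1) with hB
  have hVB : ∀ u : E, ‖u‖ ≤ 1 → V u ≤ B := fun u hu =>
    (hB₀ (mem_image_of_mem V (mem_closedBall_zero_iff.2 hu))).trans (le_max_left _ _)
  set m : Measure E := ν.withDensity fun x => ENNReal.ofReal (exp (-V x)) with hm
  have hfin : IsFiniteMeasure m := isFiniteMeasure_withDensity hint.lintegral_lt_top.ne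
  have htend : Filter.Tendsto (fun k : ℕ => m (Metric.closedBall (0 : E) k)ᶜ) Filter.atTop
      (nhds 0) := by
    have h := tendsto_measure_iInter_atTop (μ := m)
      (s := fun k : ℕ => (Metric.closedBall (0 : E) k)ᶜ)
      (fun k => Metric.isClosed_closedBall.measurableSet.compl.nullMeasurableSet)
      (fun i j hij => compl_subset_compl.2
        (Metric.closedBall_subset_closedBall (by exact_mod_cast hij)))
      ⟨0, measure_ne_top _ _⟩
    have hempty : ⋂ k : ℕ, (Metric.closedBall (0 : E) k)ᶜ = ∅ := by
      rw [← compl_iUnion, Metric.iUnion_closedBall_nat, compl_univ]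
    rwa [hempty, measure_empty] at h
  set c := ENNReal.ofReal (exp (-B)) * ν (Metric.ball (0 : E) (1 / 2)) with hc
  have hc0 : 0 < c := ENNReal.mul_pos (by simp [exp_pos])
    (Metric.measure_ball_pos ν _ (by norm_num)).ne'
  obtain ⟨k, hk⟩ := (htend.eventually (gt_mem_nhds hc0)).exists
  refine ⟨2 * k + 1, by positivity, fun x hx => ?_⟩
  by_contra! hlt
  have hsub : Metric.ball ((2 : ℝ)⁻¹ • x) (1 / 2) ⊆ (Metric.closedBall (0 : E) k)ᶜ := by
    intro p hp
    rw [mem_compl_iff, mem_closedBall_zero_iff, not_le]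
    rw [mem_ball_iff_norm'] at hp
    have h1 : ‖(2 : ℝ)⁻¹ • x‖ = ‖x‖ / 2 := by rw [norm_smul]; norm_num; ring
    have h2 := norm_sub_norm_le ((2 : ℝ)⁻¹ • x) p
    linarith
  have hVp : ∀ p ∈ Metric.ball ((2 : ℝ)⁻¹ • x) (1 / 2), V p ≤ B := by
    intro p hp
    rw [mem_ball_iff_norm] at hp
    have hu : V ((2 : ℝ) • (p - (2 : ℝ)⁻¹ • x)) ≤ B := by
      refine hVB _ ?_
      rw [norm_smul]; norm_num at hp ⊢; linarith
    have hconv := hV.2 (mem_univ x) (mem_univ ((2 : ℝ) • (p - (2 : ℝ)⁻¹ • x)))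
      (by norm_num : (0 : ℝ) ≤ 1 / 2) (by norm_num : (0 : ℝ) ≤ 1 / 2) (by norm_num)
    have hp' : (1 / 2 : ℝ) • x + (1 / 2 : ℝ) • (2 : ℝ) • (p - (2 : ℝ)⁻¹ • x) = p := by
      module
    rw [hp'] at hconv
    have : V 0 + 1 ≤ B := le_max_right _ _
    simp only [smul_eq_mul] at hconv
    linarith
  have hge : c ≤ m (Metric.ball ((2 : ℝ)⁻¹ • x) (1 / 2)) := by
    rw [hm, withDensity_apply _ Metric.isOpen_ball.measurableSet, hc,
      ← Measure.addHaar_ball_center ν ((2 : ℝ)⁻¹ • x), ← setLIntegral_const]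
    refine setLIntegral_mono' Metric.isOpen_ball.measurableSet fun p hp => ?_
    exact ENNReal.ofReal_le_ofReal (exp_le_exp.2 (neg_le_neg (hVp p hp)))
  exact absurd (hge.trans (measure_mono hsub)) (not_le.2 hk)

theorem ConvexOn.exists_linear_lower_bound {V : E → ℝ} (hV : ConvexOn ℝ univ V)
    (hint : Integrable (fun x => exp (-V x)) ν) :
    ∃ a b : ℝ, 0 < a ∧ ∀ x, a * ‖x‖ - b ≤ V x := by
  have hcont : Continuous V := continuousOn_univ.1 (hV.continuousOn isOpen_univ)
  obtain ⟨R, hR, hfar⟩ := hV.exists_far_of_integrable ν hint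
  obtain ⟨m, hm⟩ := (isCompact_closedBall (0 : E) R).bddBelow_image hcont.continuousOn
  refine ⟨R⁻¹, max (-V 0) (1 - m), by positivity, fun x => ?_⟩
  have h1 := le_max_left (-V 0) (1 - m)
  have h2 := le_max_right (-V 0) (1 - m)
  rcases le_total R ‖x‖ with hx | hx
  · have := hV.linear_growth_of_far hR hfar hx
    linarith
  · have h3 : m ≤ V x := hm (mem_image_of_mem V (mem_closedBall_zero_iff.2 hx))
    have h4 : R⁻¹ * ‖x‖ ≤ 1 := by rw [inv_mul_le_iff₀ hR]; linarith
    linarith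

end LogConcave

section Segment

variable {E : Type*} [NormedAddCommGroup E] [NormedSpace ℝ E]

theorem integral_mul_exp_neg_mul_le {δ r : ℝ} (hδ : 0 < δ) :
    ∫ s in (0 : ℝ)..(1 / 2), r * exp (-(δ * s * r)) ≤ δ⁻¹ := by
  have hderiv : ∀ s : ℝ, HasDerivAt (fun s => -(δ⁻¹ * exp (-(δ * s * r))))
      (r * exp (-(δ * s * r))) s := by
    intro s
    have h := (((hasDerivAt_id s).const_mul δ).mul_const r).neg.exp.const_mul δ⁻¹ |>.neg
    refine HasDerivAt.congr_deriv (f := fun s => -(δ⁻¹ * exp (-(δ * s * r)))) h ?_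
    simp only [Pi.neg_apply, id]
    field_simp
  rw [intervalIntegral.integral_eq_sub_of_hasDerivAt (fun s _ => hderiv s)
    (Continuous.intervalIntegrable (by fun_prop) _ _)]
  have : 0 ≤ δ⁻¹ * exp (-(δ * (1 / 2) * r)) := by positivity
  simp
  simpa using this

theorem lintegral_mul_exp_neg_mul_le {δ r : ℝ} (hδ : 0 < δ) (hr : 0 ≤ r) :
    ∫⁻ s in Ioc (0 : ℝ) (1 / 2), ENNReal.ofReal (r * exp (-(δ * s * r)))
      ≤ ENNReal.ofReal δ⁻¹ := by
  rw [← ofReal_integral_eq_lintegral_ofReal]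
  · rw [← intervalIntegral.integral_of_le (by norm_num)]
    exact ENNReal.ofReal_le_ofReal (integral_mul_exp_neg_mul_le hδ)
  · exact (Continuous.integrableOn_Icc (by fun_prop)).mono_set Ioc_subset_Icc_self
  · exact Filter.Eventually.of_forall fun s => by positivity

/-- Weighted Cauchy–Schwarz bound for the increment of `f` along half of a segment. -/
theorem sq_sub_midpoint_le {f : E → ℝ} (hf : ContDiff ℝ 1 f) {δ : ℝ} (hδ : 0 < δ) (x y : E) :
    δ * (f (x + (1 / 2 : ℝ) • (y - x)) - f x) ^ 2 ≤
      ∫ s in (0 : ℝ)..(1 / 2),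
        ‖y - x‖ * exp (δ * s * ‖y - x‖) * ‖fderiv ℝ f (x + s • (y - x))‖ ^ 2 := by
  have hfd : Continuous (fderiv ℝ f) := hf.continuous_fderiv one_ne_zero
  set r := ‖y - x‖ with hr
  set I := f (x + (1 / 2 : ℝ) • (y - x)) - f x with hI
  have hderiv : ∀ s : ℝ, HasDerivAt (fun s : ℝ => f (x + s • (y - x)))
      (fderiv ℝ f (x + s • (y - x)) (y - x)) s := by
    intro s
    have h1 : HasDerivAt (fun s : ℝ => x + s • (y - x)) (y - x) s := by
      simpa using ((hasDerivAt_id s).smul_const (y - x)).const_add x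
    exact ((hf.differentiable one_ne_zero _).hasFDerivAt).comp_hasDerivAt s h1
  have hftc : ∫ s in (0 : ℝ)..(1 / 2), fderiv ℝ f (x + s • (y - x)) (y - x) = I := by
    rw [intervalIntegral.integral_eq_sub_of_hasDerivAt (fun s _ => hderiv s)
      (Continuous.intervalIntegrable (by fun_prop) _ _)]
    simp [hI]
  have hmono : ∫ s in (0 : ℝ)..(1 / 2), 2 * (δ * I) * fderiv ℝ f (x + s • (y - x)) (y - x) ≤
      ∫ s in (0 : ℝ)..(1 / 2),
        (r * exp (δ * s * r) * ‖fderiv ℝ f (x + s • (y - x))‖ ^ 2 +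
          (δ * I) ^ 2 * (r * exp (-(δ * s * r)))) := by
    refine intervalIntegral.integral_mono_on (by norm_num)
      (Continuous.intervalIntegrable (by fun_prop) _ _)
      (Continuous.intervalIntegrable (by fun_prop) _ _) fun s _ => ?_
    set A := fderiv ℝ f (x + s • (y - x))
    have h1 : 2 * (δ * I) * A (y - x) ≤ 2 * (|δ * I| * (‖A‖ * r)) := by
      have := A.le_opNorm (y - x)
      have h2 : δ * I * A (y - x) ≤ |δ * I| * |A (y - x)| := by
        rw [← abs_mul]; exact le_abs_self _
      have h3 : |δ * I| * |A (y - x)| ≤ |δ * I| * (‖A‖ * r) := by gcongr; exact this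
      linarith
    have h2 : exp (δ * s * r) = exp (δ * s * r / 2) ^ 2 := by
      rw [← exp_nat_mul]; ring_nf
    have h3 : exp (-(δ * s * r)) = exp (-(δ * s * r / 2)) ^ 2 := by
      rw [← exp_nat_mul]; ring_nf
    have h4 : exp (δ * s * r / 2) * exp (-(δ * s * r / 2)) = 1 := by
      rw [← exp_add]; simp
    rw [h2, h3, ← sq_abs (δ * I)]
    set p := exp (δ * s * r / 2)
    set q := exp (-(δ * s * r / 2))
    have h5 : 0 ≤ r * (p * ‖A‖ - q * |δ * I|) ^ 2 := by positivity
    have h6 : r * (p * ‖A‖ - q * |δ * I|) ^ 2 =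
      r * p ^ 2 * ‖A‖ ^ 2 + |δ * I| ^ 2 * (r * q ^ 2) - 2 * (p * q) * (|δ * I| * (‖A‖ * r)) := by
      ring
    rw [h6, h4] at h5
    linarith
  rw [intervalIntegral.integral_add (Continuous.intervalIntegrable (by fun_prop) _ _)
    (Continuous.intervalIntegrable (by fun_prop) _ _), intervalIntegral.integral_const_mul,
    intervalIntegral.integral_const_mul, hftc] at hmono
  have h7 : (δ * I) ^ 2 * ∫ s in (0 : ℝ)..(1 / 2), r * exp (-(δ * s * r)) ≤
      (δ * I) ^ 2 * δ⁻¹ := by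
    gcongr; exact integral_mul_exp_neg_mul_le hδ
  have h8 : (δ * I) ^ 2 * δ⁻¹ = δ * I ^ 2 := by field_simp
  linarith [h7, h8, hmono]

theorem ofReal_sq_sub_midpoint_le {f : E → ℝ} (hf : ContDiff ℝ 1 f) {δ : ℝ} (hδ : 0 < δ)
    (x y : E) :
    ENNReal.ofReal (δ * (f x - f (midpoint ℝ x y)) ^ 2) ≤
      ∫⁻ s in Ioc (0 : ℝ) (1 / 2), ENNReal.ofReal
        (‖y - x‖ * exp (δ * s * ‖y - x‖) * ‖fderiv ℝ f (x + s • (y - x))‖ ^ 2) := by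
  have hfd : Continuous (fderiv ℝ f) := hf.continuous_fderiv one_ne_zero
  rw [← ofReal_integral_eq_lintegral_ofReal]
  · rw [← intervalIntegral.integral_of_le (by norm_num)]
    refine ENNReal.ofReal_le_ofReal ((le_of_eq ?_).trans (sq_sub_midpoint_le hf hδ x y))
    have : midpoint ℝ x y = x + (1 / 2 : ℝ) • (y - x) := by
      rw [midpoint_eq_smul_add, invOf_eq_inv]; module
    rw [this]; ring
  · exact (Continuous.integrableOn_Icc (by fun_prop)).mono_set Ioc_subset_Icc_self
  · exact Filter.Eventually.of_forall fun s => by positivity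

end Segment

section DoubleIntegral

variable {E : Type*} [NormedAddCommGroup E] [NormedSpace ℝ E]

/-- Convexity transfers weight from the endpoints of a segment to an interior point. -/
theorem ConvexOn.exp_weight_le {U : E → ℝ} (hU : ConvexOn ℝ univ U) {δ b : ℝ} (hδ : 0 < δ)
    (hlow : ∀ x, 4 * δ * ‖x‖ - b ≤ U x) {s : ℝ} (hs : s ∈ Ioc (0 : ℝ) (1 / 2)) (x y : E) :
    exp (-U x) * exp (-U y) * (‖y - x‖ * exp (δ * s * ‖y - x‖)) ≤
      2 * exp b * exp (-(δ * ‖y‖)) *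
        (‖x + s • (y - x) - y‖ * exp (-(δ * s * ‖x + s • (y - x) - y‖))) *
        exp (-U (x + s • (y - x))) := by
  obtain ⟨hs0, hs1⟩ := hs
  have hz : x + s • (y - x) - y = (1 - s) • (x - y) := by module
  have hnorm : ‖x + s • (y - x) - y‖ = (1 - s) * ‖y - x‖ := by
    rw [hz, norm_smul, norm_of_nonneg (by linarith), norm_sub_rev]
  have hconv := hU.2 (mem_univ x) (mem_univ y) (by linarith : (0 : ℝ) ≤ 1 - s) hs0.le (by ring)
  rw [show (1 - s) • x + s • y = x + s • (y - x) by module] at hconv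
  simp only [smul_eq_mul] at hconv
  set z := x + s • (y - x)
  have htri : ‖y - x‖ ≤ ‖y‖ + ‖x‖ := norm_sub_le _ _
  have hx := hlow x
  have hy := hlow y
  have h1 : s * (4 * δ * ‖x‖ - b) ≤ s * U x := by gcongr
  have h2 : (1 - s) * (4 * δ * ‖y‖ - b) ≤ (1 - s) * U y :=
    mul_le_mul_of_nonneg_left hy (by linarith)
  have h3 : δ * s * ‖y - x‖ ≤ δ * s * (‖y‖ + ‖x‖) := by gcongr
  have h4 : 0 ≤ δ * ‖y‖ * (1 / 2 - s) := mul_nonneg (by positivity) (by linarith)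
  have h5 : δ * s * ((1 - s) * ‖y - x‖) ≤ δ * s * ‖y - x‖ := by
    have : 0 ≤ δ * s * (s * ‖y - x‖) := by positivity
    linarith
  have h6 : 0 ≤ δ * s * ‖x‖ := by positivity
  have hexp : -U x + -U y + δ * s * ‖y - x‖ ≤
      b + -(δ * ‖y‖) + -(δ * s * ((1 - s) * ‖y - x‖)) + -U z := by
    nlinarith
  have hle : ‖y - x‖ ≤ 2 * ((1 - s) * ‖y - x‖) := by
    nlinarith [norm_nonneg (y - x)]
  rw [hnorm]
  calc exp (-U x) * exp (-U y) * (‖y - x‖ * exp (δ * s * ‖y - x‖))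
      = ‖y - x‖ * exp (-U x + -U y + δ * s * ‖y - x‖) := by rw [exp_add, exp_add]; ring
    _ ≤ (2 * ((1 - s) * ‖y - x‖)) *
        exp (b + -(δ * ‖y‖) + -(δ * s * ((1 - s) * ‖y - x‖)) + -U z) := by
      gcongr
      exact (norm_nonneg _).trans hle
    _ = _ := by rw [exp_add, exp_add, exp_add]; ring

variable [MeasurableSpace E] [BorelSpace E] [FiniteDimensional ℝ E]
  (ν : Measure E) [ν.IsAddHaarMeasure]

theorem lintegral_comp_segment_le {s : ℝ} (hs : s ∈ Ioc (0 : ℝ) (1 / 2)) (y : E)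
    {F : E → ℝ≥0∞} (hF : Measurable F) :
    ∫⁻ x, F (x + s • (y - x)) ∂ν ≤ 2 ^ Module.finrank ℝ E * ∫⁻ z, F z ∂ν := by
  have h1s : (1 : ℝ) / 2 ≤ 1 - s := by linarith [hs.2]
  have hpos : 0 < 1 - s := by linarith
  have hfun : ∀ x : E, x + s • (y - x) = (1 - s) • x + s • y := fun x => by module
  simp_rw [hfun]
  rw [← lintegral_map (f := fun x => F (x + s • y)) (by fun_prop) (measurable_const_smul (1 - s)),
    Measure.map_addHaar_smul ν hpos.ne', lintegral_smul_measure, lintegral_add_right_eq_self,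
    smul_eq_mul]
  gcongr
  rw [abs_of_nonneg (by positivity), ← inv_pow, ENNReal.ofReal_pow (by positivity)]
  gcongr
  rw [ENNReal.ofReal_le_iff_le_toReal (by simp)]
  simpa using inv_anti₀ (by norm_num) h1s

theorem lintegral_exp_neg_mul_norm_lt_top [Nontrivial E] {δ : ℝ} (hδ : 0 < δ) :
    ∫⁻ y, ENNReal.ofReal (exp (-(δ * ‖y‖))) ∂ν < ∞ := by
  refine Integrable.lintegral_lt_top ((integrable_fun_norm_addHaar ν
    (f := fun r => exp (-(δ * r)))).2 ?_)
  have h := integrableOn_rpow_mul_exp_neg_mul_rpow (s := (Module.finrank ℝ E - 1 : ℕ)) (p := 1)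
    (b := δ) (by have := Nat.cast_nonneg (α := ℝ) (Module.finrank ℝ E - 1); linarith) one_pos hδ
  refine h.congr_fun (fun r _ => ?_) measurableSet_Ioi
  simp

/-- The core estimate: the segment energies, averaged over both endpoints, are controlled by the
energy. -/
theorem ConvexOn.lintegral_segment_le {U : E → ℝ} (hU : ConvexOn ℝ univ U)
    {δ b : ℝ} (hδ : 0 < δ) (hlow : ∀ x, 4 * δ * ‖x‖ - b ≤ U x)
    {G : E → ℝ} (hG : Continuous G) (hG0 : ∀ x, 0 ≤ G x) :
    ∫⁻ x, ∫⁻ y, (∫⁻ s in Ioc (0 : ℝ) (1 / 2), ENNReal.ofReal (exp (-U x) * exp (-U y) *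
        (‖y - x‖ * exp (δ * s * ‖y - x‖) * G (x + s • (y - x))))) ∂ν ∂ν ≤
      2 ^ Module.finrank ℝ E * (ENNReal.ofReal (2 * exp b * δ⁻¹) *
        ∫⁻ y, ENNReal.ofReal (exp (-(δ * ‖y‖))) ∂ν) *
        ∫⁻ z, ENNReal.ofReal (exp (-U z) * G z) ∂ν := by
  have hcont : Continuous U := continuousOn_univ.1 (hU.continuousOn isOpen_univ)
  set I : Set ℝ := Ioc (0 : ℝ) (1 / 2)
  set H : ℝ → E → E → ℝ≥0∞ := fun s y z => ENNReal.ofReal (2 * exp b * exp (-(δ * ‖y‖)) *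
        (‖z - y‖ * exp (-(δ * s * ‖z - y‖))) * exp (-U z) * G z) with hH
  calc _ ≤ ∫⁻ x, ∫⁻ y, (∫⁻ s in I, H s y (x + s • (y - x))) ∂ν ∂ν := by
        refine lintegral_mono fun x => lintegral_mono fun y =>
          setLIntegral_mono' measurableSet_Ioc fun s hs => ENNReal.ofReal_le_ofReal ?_
        rw [← mul_assoc]
        exact mul_le_mul_of_nonneg_right (hU.exp_weight_le hδ hlow hs x y) (hG0 _)
    _ = ∫⁻ y, (∫⁻ s in I, ∫⁻ x, H s y (x + s • (y - x)) ∂ν) ∂ν := by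
        rw [lintegral_lintegral_swap]
        · refine lintegral_congr fun y => lintegral_lintegral_swap ?_
          exact Measurable.aemeasurable (by unfold Function.uncurry; fun_prop)
        · refine Measurable.aemeasurable ?_
          exact Measurable.lintegral_prod_right' (ν := volume.restrict I)
            (f := fun p : (E × E) × ℝ => H p.2 p.1.2 (p.1.1 + p.2 • (p.1.2 - p.1.1))) (by fun_prop)
    _ ≤ ∫⁻ y, (∫⁻ s in I, 2 ^ Module.finrank ℝ E * ∫⁻ z, H s y z ∂ν) ∂ν :=
        lintegral_mono fun y => setLIntegral_mono' measurableSet_Ioc fun s hs =>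
          lintegral_comp_segment_le ν hs y (by fun_prop)
    _ = 2 ^ Module.finrank ℝ E * ∫⁻ y, ∫⁻ z, (∫⁻ s in I, H s y z) ∂ν ∂ν := by
        rw [← lintegral_const_mul' _ _ (by simp)]
        refine lintegral_congr fun y => ?_
        rw [lintegral_const_mul' _ _ (by simp), lintegral_lintegral_swap]
        exact Measurable.aemeasurable (by unfold Function.uncurry; fun_prop)
    _ ≤ 2 ^ Module.finrank ℝ E * ∫⁻ y, ∫⁻ z, ENNReal.ofReal (2 * exp b * δ⁻¹) *
          ENNReal.ofReal (exp (-(δ * ‖y‖))) * ENNReal.ofReal (exp (-U z) * G z) ∂ν ∂ν := by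
        gcongr with y z
        have hsplit : ∀ s, H s y z = ENNReal.ofReal (2 * exp b * exp (-(δ * ‖y‖)) *
            (exp (-U z) * G z)) * ENNReal.ofReal (‖z - y‖ * exp (-(δ * s * ‖z - y‖))) := by
          intro s
          rw [← ENNReal.ofReal_mul (by have := hG0 z; positivity)]
          simp only [hH]; congr 1; ring
        simp_rw [hsplit]
        rw [lintegral_const_mul' _ _ (by simp)]
        refine (mul_le_mul_right (lintegral_mul_exp_neg_mul_le hδ (norm_nonneg _)) _).trans_eq ?_
        have := hG0 z
        rw [← ENNReal.ofReal_mul (by positivity), ← ENNReal.ofReal_mul (by positivity),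
          ← ENNReal.ofReal_mul (by positivity)]
        congr 1; ring
    _ = _ := by
        have hy : ∀ y : E, ∫⁻ z, ENNReal.ofReal (2 * exp b * δ⁻¹) *
            ENNReal.ofReal (exp (-(δ * ‖y‖))) * ENNReal.ofReal (exp (-U z) * G z) ∂ν =
            ENNReal.ofReal (2 * exp b * δ⁻¹) * ENNReal.ofReal (exp (-(δ * ‖y‖))) *
              ∫⁻ z, ENNReal.ofReal (exp (-U z) * G z) ∂ν := fun y =>
          lintegral_const_mul _ (by fun_prop)
        simp_rw [hy]
        rw [lintegral_mul_const _ (by fun_prop), lintegral_const_mul _ (by fun_prop)]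
        ring

end DoubleIntegral

section Poincare

theorem ofReal_two_mul_variance_eq {Ω : Type*} [MeasurableSpace Ω] (μ : Measure Ω)
    [IsProbabilityMeasure μ] {f : Ω → ℝ} (hf : Integrable f μ)
    (hf2 : Integrable (fun x => f x ^ 2) μ) :
    ENNReal.ofReal (2 * (∫ x, f x ^ 2 ∂μ - (∫ x, f x ∂μ) ^ 2)) =
      ∫⁻ x, ∫⁻ y, ENNReal.ofReal ((f x - f y) ^ 2) ∂μ ∂μ := by
  set m := ∫ x, f x ∂μ with hm
  set q := ∫ x, f x ^ 2 ∂μ with hq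
  have hexpand : ∀ x y, (f x - f y) ^ 2 = f x ^ 2 - 2 * f x * f y + f y ^ 2 := fun x y => by ring
  have hintx : ∀ x, Integrable (fun y => f x ^ 2 - 2 * f x * f y) μ := fun x =>
    (integrable_const _).sub (hf.const_mul _)
  have hinner : ∀ x, ∫⁻ y, ENNReal.ofReal ((f x - f y) ^ 2) ∂μ =
      ENNReal.ofReal (f x ^ 2 - 2 * m * f x + q) := by
    intro x
    rw [← ofReal_integral_eq_lintegral_ofReal]
    · simp_rw [hexpand]
      rw [integral_add (hintx x) hf2, integral_sub (integrable_const _) (hf.const_mul _),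
        integral_const_mul, integral_const]
      congr 1
      simp only [probReal_univ, one_smul, ← hm, ← hq]
      ring
    · simp_rw [hexpand]
      exact (hintx x).add hf2
    · exact Filter.Eventually.of_forall fun y => sq_nonneg _
  have hsub : Integrable (fun x => f x ^ 2 - 2 * m * f x) μ := hf2.sub (hf.const_mul _)
  have hq0 : m ^ 2 ≤ q := by
    have h : 0 ≤ ∫ x, (f x - m) ^ 2 ∂μ := integral_nonneg fun x => sq_nonneg _
    have h1 : ∀ x, (f x - m) ^ 2 = f x ^ 2 - 2 * m * f x + m ^ 2 := fun x => by ring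
    simp_rw [h1] at h
    rw [integral_add hsub (integrable_const _), integral_sub hf2 (hf.const_mul _),
      integral_const_mul, integral_const] at h
    simp only [probReal_univ, one_smul, ← hm, ← hq] at h
    linarith
  simp_rw [hinner]
  rw [← ofReal_integral_eq_lintegral_ofReal]
  · rw [integral_add hsub (integrable_const _), integral_sub hf2 (hf.const_mul _),
      integral_const_mul, integral_const]
    congr 1
    simp only [probReal_univ, one_smul, ← hm, ← hq]
    ring
  · exact hsub.add (integrable_const _)
  · exact Filter.Eventually.of_forall fun x => by
      change 0 ≤ f x ^ 2 - 2 * m * f x + q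
      nlinarith [sq_nonneg (f x - m)]

variable {E : Type*} [NormedAddCommGroup E] [NormedSpace ℝ E] [MeasurableSpace E] [BorelSpace E]
  [FiniteDimensional ℝ E] (ν : Measure E) [ν.IsAddHaarMeasure]

theorem lintegral_sq_sub_le_midpoint (μ : Measure E) [SFinite μ] {f : E → ℝ}
    (hf : Continuous f) {δ : ℝ} (hδ : 0 < δ) :
    ∫⁻ x, ∫⁻ y, ENNReal.ofReal (δ * (f x - f y) ^ 2) ∂μ ∂μ ≤
      4 * ∫⁻ x, ∫⁻ y, ENNReal.ofReal (δ * (f x - f (midpoint ℝ x y)) ^ 2) ∂μ ∂μ := by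
  have hmid : Continuous fun p : E × E => midpoint ℝ p.1 p.2 := by
    simp_rw [midpoint_eq_smul_add]; fun_prop
  set T : E → E → ℝ≥0∞ := fun x y =>
    ENNReal.ofReal (2 * (δ * (f x - f (midpoint ℝ x y)) ^ 2)) with hT
  have hTm : Measurable (Function.uncurry T) := by
    unfold Function.uncurry
    exact (ENNReal.continuous_ofReal.comp (by fun_prop)).measurable
  have hpt : ∀ x y, ENNReal.ofReal (δ * (f x - f y) ^ 2) ≤ T x y + T y x := by
    intro x y
    rw [hT, ← ENNReal.ofReal_add (by positivity) (by positivity), midpoint_comm y x]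
    refine ENNReal.ofReal_le_ofReal ?_
    nlinarith [mul_nonneg hδ.le (sq_nonneg
      ((f x - f (midpoint ℝ x y)) + (f y - f (midpoint ℝ x y))))]
  calc _ ≤ ∫⁻ x, ∫⁻ y, (T x y + T y x) ∂μ ∂μ :=
        lintegral_mono fun x => lintegral_mono fun y => hpt x y
    _ = ∫⁻ x, ∫⁻ y, T x y ∂μ ∂μ + ∫⁻ x, ∫⁻ y, T y x ∂μ ∂μ := by
        rw [← lintegral_add_left (f := fun x => ∫⁻ y, T x y ∂μ) hTm.lintegral_prod_right']
        exact lintegral_congr fun x => lintegral_add_left (hTm.comp measurable_prodMk_left) _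
    _ = 2 * ∫⁻ x, ∫⁻ y, T x y ∂μ ∂μ := by
        rw [two_mul, lintegral_lintegral_swap (f := fun x y => T y x)
          (hTm.comp measurable_swap).aemeasurable]
    _ = _ := by
        simp_rw [hT, ENNReal.ofReal_mul (zero_le_two (α := ℝ))]
        simp_rw [lintegral_const_mul' _ _ ENNReal.ofReal_ne_top]
        rw [← mul_assoc]
        norm_num

theorem ConvexOn.exists_poincare_lintegral [Nontrivial E] {U : E → ℝ} (hU : ConvexOn ℝ univ U)
    (hint : Integrable (fun x => exp (-U x)) ν) {μ : Measure E} [SFinite μ]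
    (hμ : μ = ν.withDensity fun x => ENNReal.ofReal (exp (-U x))) :
    ∃ K : ℝ≥0∞, K ≠ ∞ ∧ ∀ f : E → ℝ, ContDiff ℝ 1 f →
      ∫⁻ x, ∫⁻ y, ENNReal.ofReal ((f x - f y) ^ 2) ∂μ ∂μ ≤
        K * ∫⁻ z, ENNReal.ofReal (‖fderiv ℝ f z‖ ^ 2) ∂μ := by
  have hcont : Continuous U := continuousOn_univ.1 (hU.continuousOn isOpen_univ)
  obtain ⟨a, b, ha, hlow⟩ := hU.exists_linear_lower_bound ν hint
  obtain ⟨δ, hδ, rfl⟩ : ∃ δ : ℝ, 0 < δ ∧ a = 4 * δ := ⟨a / 4, by positivity, by ring⟩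
  set M : ℝ≥0∞ := 2 ^ Module.finrank ℝ E * (ENNReal.ofReal (2 * exp b * δ⁻¹) *
    ∫⁻ y, ENNReal.ofReal (exp (-(δ * ‖y‖))) ∂ν) with hM
  have hMtop : M ≠ ∞ := ENNReal.mul_ne_top (by simp)
    (ENNReal.mul_ne_top ENNReal.ofReal_ne_top (lintegral_exp_neg_mul_norm_lt_top ν hδ).ne)
  refine ⟨ENNReal.ofReal δ⁻¹ * (4 * M),
    ENNReal.mul_ne_top ENNReal.ofReal_ne_top (ENNReal.mul_ne_top (by simp) hMtop), fun f hf => ?_⟩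
  have hfc : Continuous f := hf.continuous
  have hfd : Continuous (fderiv ℝ f) := hf.continuous_fderiv one_ne_zero
  have hmid : Continuous fun p : E × E => midpoint ℝ p.1 p.2 := by
    simp_rw [midpoint_eq_smul_add]; fun_prop
  have hdens : ∀ {g : E → ℝ≥0∞}, Measurable g →
      ∫⁻ x, g x ∂μ = ∫⁻ x, ENNReal.ofReal (exp (-U x)) * g x ∂ν := fun hg => by
    rw [hμ, lintegral_withDensity_eq_lintegral_mul _ (by fun_prop) hg]; rfl
  have hT : Measurable fun p : E × E =>
      ENNReal.ofReal (δ * (f p.1 - f (midpoint ℝ p.1 p.2)) ^ 2) :=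
    (ENNReal.continuous_ofReal.comp (by fun_prop)).measurable
  have hmain : ∫⁻ x, ∫⁻ y, ENNReal.ofReal (δ * (f x - f (midpoint ℝ x y)) ^ 2) ∂μ ∂μ ≤
      M * ∫⁻ z, ENNReal.ofReal (‖fderiv ℝ f z‖ ^ 2) ∂μ := by
    calc _ = ∫⁻ x, ∫⁻ y, ENNReal.ofReal (exp (-U x) * exp (-U y)) *
          ENNReal.ofReal (δ * (f x - f (midpoint ℝ x y)) ^ 2) ∂ν ∂ν := by
          rw [hdens hT.lintegral_prod_right']
          refine lintegral_congr fun x => ?_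
          have hTx : Measurable fun y => ENNReal.ofReal (δ * (f x - f (midpoint ℝ x y)) ^ 2) :=
            hT.comp measurable_prodMk_left
          change _ * ∫⁻ y, ENNReal.ofReal (δ * (f x - f (midpoint ℝ x y)) ^ 2) ∂μ = _
          rw [hdens hTx, ← lintegral_const_mul' _ _ ENNReal.ofReal_ne_top]
          refine lintegral_congr fun y => ?_
          rw [← mul_assoc, ← ENNReal.ofReal_mul (exp_pos _).le]
      _ ≤ ∫⁻ x, ∫⁻ y, (∫⁻ s in Ioc (0 : ℝ) (1 / 2), ENNReal.ofReal (exp (-U x) * exp (-U y) *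
          (‖y - x‖ * exp (δ * s * ‖y - x‖) * ‖fderiv ℝ f (x + s • (y - x))‖ ^ 2))) ∂ν ∂ν := by
          refine lintegral_mono fun x => lintegral_mono fun y => ?_
          refine (mul_le_mul_right (ofReal_sq_sub_midpoint_le hf hδ x y) _).trans_eq ?_
          rw [← lintegral_const_mul' _ _ ENNReal.ofReal_ne_top]
          refine lintegral_congr fun s => ?_
          rw [← ENNReal.ofReal_mul (by positivity)]
      _ ≤ M * ∫⁻ z, ENNReal.ofReal (exp (-U z) * ‖fderiv ℝ f z‖ ^ 2) ∂ν :=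
          hU.lintegral_segment_le ν hδ hlow (by fun_prop) fun x => by positivity
      _ = _ := by
          rw [hdens (by fun_prop)]
          simp_rw [ENNReal.ofReal_mul (exp_pos _).le]
  calc _ = ENNReal.ofReal δ⁻¹ * ∫⁻ x, ∫⁻ y, ENNReal.ofReal (δ * (f x - f y) ^ 2) ∂μ ∂μ := by
        rw [← lintegral_const_mul' _ _ ENNReal.ofReal_ne_top]
        refine lintegral_congr fun x => ?_
        rw [← lintegral_const_mul' _ _ ENNReal.ofReal_ne_top]
        refine lintegral_congr fun y => ?_
        rw [← ENNReal.ofReal_mul (by positivity), inv_mul_cancel_left₀ hδ.ne']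
    _ ≤ ENNReal.ofReal δ⁻¹ * (4 * (M * ∫⁻ z, ENNReal.ofReal (‖fderiv ℝ f z‖ ^ 2) ∂μ)) := by
        gcongr
        exact (lintegral_sq_sub_le_midpoint μ hfc hδ).trans (by gcongr)
    _ = _ := by ring

/-- The normalised density `e^{-V}/Z` is again of the form `e^{-U}` with `U = V + log Z`. -/
theorem boltz_eq_withDensity_exp {n : ℕ} {V : En n → ℝ} (hZ : 0 < ∫ y, exp (-V y)) :
    boltz V = (volume : Measure (En n)).withDensity
      fun x => ENNReal.ofReal (exp (-(V x + log (∫ y, exp (-V y))))) := by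
  unfold boltz
  congr 1 with x
  rw [neg_add, exp_add, exp_neg (log _), exp_log hZ, div_eq_mul_inv]

theorem isProbabilityMeasure_boltz {n : ℕ} {V : En n → ℝ}
    (hVint : Integrable (fun x => exp (-V x))) (hZ : 0 < ∫ y, exp (-V y)) :
    IsProbabilityMeasure (boltz V) := by
  constructor
  rw [boltz, withDensity_apply _ MeasurableSet.univ, Measure.restrict_univ,
    ← ofReal_integral_eq_lintegral_ofReal (hVint.div_const _)
      (Filter.Eventually.of_forall fun x => by positivity),
    integral_div, div_self hZ.ne', ENNReal.ofReal_one]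

end Poincare

/-- Bobkov: every log-concave probability measure `dμ = e^{-V}/Z dx`, `V`
convex, satisfies a Poincaré inequality. -/
theorem stmt5 {n : ℕ} (hn : 0 < n) (V : En n → ℝ)
    (hVconv : ConvexOn ℝ Set.univ V)
    (hVint : Integrable (fun x => Real.exp (-V x))) :
    ∃ C : ℝ, 0 < C ∧ ∀ f : En n → ℝ, ContDiff ℝ (⊤ : ℕ∞) f → HasCompactSupport f →
      ∫ x, (f x) ^ 2 ∂(boltz V) - (∫ x, f x ∂(boltz V)) ^ 2
        ≤ C * ∫ x, ‖gradient f x‖ ^ 2 ∂(boltz V) := by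
  have : Nonempty (Fin n) := ⟨⟨0, hn⟩⟩
  have hZ : 0 < ∫ y, exp (-V y) := integral_exp_pos hVint
  have hprob := isProbabilityMeasure_boltz hVint hZ
  have hUint : Integrable fun x => exp (-(V x + log (∫ y, exp (-V y)))) := by
    simp_rw [neg_add, exp_add]
    exact hVint.mul_const _
  have hUconv : ConvexOn ℝ univ fun x => V x + log (∫ y, exp (-V y)) := hVconv.add_const _
  obtain ⟨K, hK, hpoinc⟩ := hUconv.exists_poincare_lintegral volume hUint
    (boltz_eq_withDensity_exp hZ)
  refine ⟨K.toReal / 2 + 1, by positivity, fun f hf hsupp => ?_⟩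
  have hf1 : ContDiff ℝ 1 f := hf.of_le (by exact_mod_cast le_top)
  have hfd : Continuous (fderiv ℝ f) := hf1.continuous_fderiv one_ne_zero
  have hgrad : ∀ x, ‖gradient f x‖ = ‖fderiv ℝ f x‖ := fun x => by simp [gradient]
  simp_rw [hgrad]
  have hG : Integrable (fun x => ‖fderiv ℝ f x‖ ^ 2) (boltz V) :=
    Continuous.integrable_of_hasCompactSupport (by fun_prop)
      ((hsupp.fderiv ℝ).comp_left (g := fun A => ‖A‖ ^ 2) (by simp))
  have hfi : Integrable f (boltz V) := hf.continuous.integrable_of_hasCompactSupport hsupp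
  have hf2 : Integrable (fun x => f x ^ 2) (boltz V) :=
    Continuous.integrable_of_hasCompactSupport (hf.continuous.pow 2)
      (hsupp.mono fun x hx => by
        contrapose! hx
        simp [Function.notMem_support.1 hx])
  have hG0 : 0 ≤ ∫ x, ‖fderiv ℝ f x‖ ^ 2 ∂(boltz V) := integral_nonneg fun x => by positivity
  have hle := hpoinc f hf1
  rw [← ofReal_two_mul_variance_eq _ hfi hf2, ← ofReal_integral_eq_lintegral_ofReal hG
    (Filter.Eventually.of_forall fun x => by positivity), ← ENNReal.ofReal_toReal hK,
    ← ENNReal.ofReal_mul ENNReal.toReal_nonneg,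
    ENNReal.ofReal_le_ofReal_iff (mul_nonneg ENNReal.toReal_nonneg hG0)] at hle
  linarith
end
end
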